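/- arXiv:1910.08882 — 3 statements merged into one kernel-verified Lean document; each statement's English description precedes it below -/
import Mathlib

section
/- Let a, b > −1 and let {p_n^{(a,b)}}_{n≥0} be the monic Jacobi polynomials, i.e. p_n^{(a,b)} is monic of degree n and ∫_{−1}^{1} p_n^{(a,b)}(z) p_m^{(a,b)}(z) (1−z)^a (1+z)^b dz = 0 for n ≠ m. Then for all integers m, n ≥ 0, (1/2) ∫_{−1}^{1} (p_{2m}^{(a,b)}(z) (p_{2n+1}^{(a,b)})'(z) − (p_{2m}^{(a,b)})'(z) p_{2n+1}^{(a,b)}(z)) (1−z)^{a+1} (1+z)^{b+1} dz = h4_{2n} δ_{n,m} − h4_{2m−1} δ_{m−1,n}, where h4_j = 2^{a+b+2j+2} Γ(j+2)Γ(j+a+2)Γ(j+b+2)Γ(j+a+b+2) / [Γ(2j+a+b+2)Γ(2j+a+b+4)]. -/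
open MeasureTheory Polynomial

/-- The Jacobi β = 4 normalisations
`h4_j = 2^{a+b+2j+2} Γ(j+2)Γ(j+a+2)Γ(j+b+2)Γ(j+a+b+2) / (Γ(2j+a+b+2)Γ(2j+a+b+4))`. -/
noncomputable def h4Jacobi (a b j : ℝ) : ℝ :=
  (2 : ℝ) ^ (a + b + 2 * j + 2) * Real.Gamma (j + 2) * Real.Gamma (j + a + 2)
    * Real.Gamma (j + b + 2) * Real.Gamma (j + a + b + 2)
    / (Real.Gamma (2 * j + a + b + 2) * Real.Gamma (2 * j + a + b + 4))

section Weight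

variable {a b : ℝ}

lemma intervalIntegrable_betaDensity (ha : -1 < a) (hb : -1 < b) :
    IntervalIntegrable (fun x : ℝ => x ^ b * (1 - x) ^ a) volume 0 1 := by
  have h := Complex.betaIntegral_convergent (u := (b + 1 : ℝ)) (v := (a + 1 : ℝ))
    (by simp only [Complex.ofReal_re]; linarith) (by simp only [Complex.ofReal_re]; linarith)
  rw [intervalIntegrable_iff_integrableOn_Ioc_of_le zero_le_one] at h ⊢
  refine IntegrableOn.congr_fun h.re (fun x hx => ?_) measurableSet_Ioc
  have h1 : (0 : ℝ) ≤ 1 - x := by linarith [hx.2]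
  simp only [Complex.ofReal_add, Complex.ofReal_one, add_sub_cancel_right]
  rw [← Complex.ofReal_one, ← Complex.ofReal_sub, ← Complex.ofReal_cpow hx.1.le,
    ← Complex.ofReal_cpow h1, ← Complex.ofReal_mul]
  simp

lemma integral_betaDensity (ha : -1 < a) (hb : -1 < b) :
    ∫ x in (0 : ℝ)..1, x ^ b * (1 - x) ^ a
      = Real.Gamma (a + 1) * Real.Gamma (b + 1) / Real.Gamma (a + b + 2) := by
  have h := Complex.betaIntegral_eq_Gamma_mul_div (b + 1 : ℝ) (a + 1 : ℝ)
    (by simp only [Complex.ofReal_re]; linarith) (by simp only [Complex.ofReal_re]; linarith)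
  have h2 : Complex.betaIntegral (b + 1 : ℝ) (a + 1 : ℝ)
      = ((∫ x in (0 : ℝ)..1, x ^ b * (1 - x) ^ a : ℝ) : ℂ) := by
    rw [Complex.betaIntegral, ← intervalIntegral.integral_ofReal]
    refine intervalIntegral.integral_congr fun x hx => ?_
    rw [Set.uIcc_of_le zero_le_one] at hx
    have h1 : (0 : ℝ) ≤ 1 - x := by linarith [hx.2]
    simp only [Complex.ofReal_add, Complex.ofReal_one, add_sub_cancel_right, Complex.ofReal_mul,
      Complex.ofReal_cpow hx.1, Complex.ofReal_cpow h1, Complex.ofReal_sub]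
  rw [h2, ← Complex.ofReal_add, Complex.Gamma_ofReal, Complex.Gamma_ofReal,
    Complex.Gamma_ofReal] at h
  rw [show a + b + 2 = b + 1 + (a + 1) by ring, mul_comm (Real.Gamma (a + 1))]
  exact_mod_cast h

lemma jacobiWeight_eq {z : ℝ} (hz : z ∈ Set.Icc (-1 : ℝ) 1) :
    (1 - z) ^ a * (1 + z) ^ b
      = 2 ^ (a + b) * ((1 / 2 + z / 2) ^ b * (1 - (1 / 2 + z / 2)) ^ a) := by
  have h1 : (0 : ℝ) ≤ 1 / 2 + z / 2 := by linarith [hz.1]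
  have h2 : (0 : ℝ) ≤ 1 - (1 / 2 + z / 2) := by linarith [hz.2]
  rw [Real.rpow_add two_pos, show 1 - z = 2 * (1 - (1 / 2 + z / 2)) by ring,
    show 1 + z = 2 * (1 / 2 + z / 2) by ring, Real.mul_rpow two_pos.le h1,
    Real.mul_rpow two_pos.le h2]
  ring

lemma integrableOn_jacobiWeight (ha : -1 < a) (hb : -1 < b) :
    IntegrableOn (fun z : ℝ => (1 - z) ^ a * (1 + z) ^ b) (Set.Ioo (-1) 1) := by
  have h := ((intervalIntegrable_betaDensity ha hb).comp_add_left (1 / 2)).comp_mul_left (c := 1 / 2)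
  norm_num at h
  rw [intervalIntegrable_iff_integrableOn_Ioo_of_le (by norm_num)] at h
  refine IntegrableOn.congr_fun (h.const_mul (2 ^ (a + b))) (fun z hz => ?_) measurableSet_Ioo
  rw [jacobiWeight_eq ⟨hz.1.le, hz.2.le⟩]
  ring_nf

lemma integral_jacobiWeight (ha : -1 < a) (hb : -1 < b) :
    ∫ z in Set.Ioo (-1 : ℝ) 1, (1 - z) ^ a * (1 + z) ^ b
      = 2 ^ (a + b + 1) * Real.Gamma (a + 1) * Real.Gamma (b + 1) / Real.Gamma (a + b + 2) := by
  rw [setIntegral_congr_fun measurableSet_Ioo fun z hz => jacobiWeight_eq ⟨hz.1.le, hz.2.le⟩,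
    ← integral_Ioc_eq_integral_Ioo, ← intervalIntegral.integral_of_le (by norm_num),
    intervalIntegral.integral_const_mul,
    intervalIntegral.integral_comp_add_div (fun x : ℝ => x ^ b * (1 - x) ^ a) two_ne_zero]
  norm_num
  rw [integral_betaDensity ha hb, Real.rpow_add_one two_ne_zero, Real.rpow_add two_pos]
  ring

lemma integrableOn_eval_mul_jacobiWeight (ha : -1 < a) (hb : -1 < b) (q : ℝ[X]) :
    IntegrableOn (fun z : ℝ => q.eval z * ((1 - z) ^ a * (1 + z) ^ b)) (Set.Ioo (-1) 1) := by
  have h := (integrableOn_jacobiWeight ha hb).mul_continuousOn_of_subset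
    q.continuous.continuousOn measurableSet_Ioo isCompact_Icc Set.Ioo_subset_Icc_self
  exact h.congr_fun (fun z _ => mul_comm _ _) measurableSet_Ioo

/-- Integration of polynomials against the Jacobi weight `(1-z)^a (1+z)^b` on `(-1,1)`. -/
noncomputable def jacobiIntegral (ha : -1 < a) (hb : -1 < b) : ℝ[X] →ₗ[ℝ] ℝ where
  toFun q := ∫ z in Set.Ioo (-1 : ℝ) 1, q.eval z * ((1 - z) ^ a * (1 + z) ^ b)
  map_add' p q := by
    simp only [eval_add, add_mul]
    exact integral_add (integrableOn_eval_mul_jacobiWeight ha hb p)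
      (integrableOn_eval_mul_jacobiWeight ha hb q)
  map_smul' c q := by
    simp only [eval_smul, smul_eq_mul, mul_assoc, integral_const_mul, RingHom.id_apply]

lemma jacobiIntegral_apply (ha : -1 < a) (hb : -1 < b) (q : ℝ[X]) :
    jacobiIntegral ha hb q
      = ∫ z in Set.Ioo (-1 : ℝ) 1, q.eval z * ((1 - z) ^ a * (1 + z) ^ b) := rfl

lemma jacobiIntegral_one (ha : -1 < a) (hb : -1 < b) :
    jacobiIntegral ha hb 1
      = 2 ^ (a + b + 1) * Real.Gamma (a + 1) * Real.Gamma (b + 1) / Real.Gamma (a + b + 2) := by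
  simp only [jacobiIntegral_apply, eval_one, one_mul, integral_jacobiWeight ha hb]

lemma neg_one_lt_add_one {x : ℝ} (hx : -1 < x) : -1 < x + 1 := by linarith

lemma jacobiIntegral_add_one (ha : -1 < a) (hb : -1 < b) (q : ℝ[X]) :
    jacobiIntegral (neg_one_lt_add_one ha) (neg_one_lt_add_one hb) q
      = jacobiIntegral ha hb ((1 - X ^ 2) * q) := by
  refine setIntegral_congr_fun measurableSet_Ioo fun z hz => ?_
  have h1 : (1 - z) ≠ 0 := by linarith [hz.2]
  have h2 : (1 + z) ≠ 0 := by linarith [hz.1]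
  simp only [Real.rpow_add_one h1, Real.rpow_add_one h2, eval_mul, eval_sub, eval_one, eval_pow,
    eval_X]
  ring

/-- The integral of the derivative of `q · (1-z)^(a+1) (1+z)^(b+1)` vanishes. -/
lemma jacobiIntegral_deriv (ha : -1 < a) (hb : -1 < b) (q : ℝ[X]) :
    jacobiIntegral ha hb
      ((1 - X ^ 2) * derivative q + (C (b - a) - C (a + b + 2) * X) * q) = 0 := by
  have hcont : ContinuousOn (fun z : ℝ => q.eval z * ((1 - z) ^ (a + 1) * (1 + z) ^ (b + 1)))
      (Set.Icc (-1) 1) := by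
    refine Continuous.continuousOn (q.continuous.mul (Continuous.mul ?_ ?_))
    · exact (continuous_const.sub continuous_id).rpow_const fun _ => Or.inr (by linarith)
    · exact (continuous_const.add continuous_id).rpow_const fun _ => Or.inr (by linarith)
  have hderiv : ∀ z ∈ Set.Ioo (-1 : ℝ) 1,
      HasDerivAt (fun z : ℝ => q.eval z * ((1 - z) ^ (a + 1) * (1 + z) ^ (b + 1)))
        (((1 - X ^ 2) * derivative q + (C (b - a) - C (a + b + 2) * X) * q).eval z
          * ((1 - z) ^ a * (1 + z) ^ b)) z := by
    intro z hz
    have h1 : (1 - z) ≠ 0 := by linarith [hz.2]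
    have h2 : (1 + z) ≠ 0 := by linarith [hz.1]
    have d1 := ((hasDerivAt_id z).const_sub 1).rpow_const (p := a + 1) (Or.inl h1)
    have d2 := ((hasDerivAt_id z).const_add 1).rpow_const (p := b + 1) (Or.inl h2)
    refine ((q.hasDerivAt z).mul (d1.mul d2)).congr_deriv ?_
    simp only [id_eq, add_sub_cancel_right, Real.rpow_add_one h1, Real.rpow_add_one h2, eval_add,
      eval_mul, eval_sub, eval_one, eval_pow, eval_X, eval_C, Pi.mul_apply]
    ring
  have key := intervalIntegral.integral_eq_sub_of_hasDerivAt_of_le (by norm_num) hcont hderiv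
    ((intervalIntegrable_iff_integrableOn_Ioo_of_le (by norm_num)).2
      (integrableOn_eval_mul_jacobiWeight ha hb _))
  rw [intervalIntegral.integral_of_le (by norm_num), integral_Ioc_eq_integral_Ioo] at key
  rw [jacobiIntegral_apply, key]
  have h1 : a + 1 ≠ 0 := by linarith
  have h2 : b + 1 ≠ 0 := by linarith
  simp [Real.zero_rpow h1, Real.zero_rpow h2]

end Weight

section FirstOrder

/-- The first order operator `(1 - X²) d/dX + (c - d X)`. -/
noncomputable def firstOrder (c d : ℝ) (s : ℝ[X]) : ℝ[X] :=
  (1 - X ^ 2) * derivative s + (C c - C d * X) * s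

lemma firstOrder_eq (c d : ℝ) (s : ℝ[X]) :
    firstOrder c d s = derivative s + C c * s - X * (X * derivative s + C d * s) := by
  unfold firstOrder
  ring

lemma coeff_X_mul_derivative (s : ℝ[X]) (n : ℕ) :
    (X * derivative s).coeff n = n * s.coeff n := by
  cases n with
  | zero => simp
  | succ n => rw [coeff_X_mul, coeff_derivative]; push_cast; ring

lemma coeff_firstOrder_succ (c d : ℝ) {s : ℝ[X]} {n : ℕ} (hs : s.natDegree ≤ n) :
    (firstOrder c d s).coeff (n + 1) = -(n + d) * s.coeff n := by
  have h1 : s.coeff (n + 1) = 0 := coeff_eq_zero_of_natDegree_lt (by omega)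
  have h2 : s.coeff (n + 1 + 1) = 0 := coeff_eq_zero_of_natDegree_lt (by omega)
  rw [firstOrder_eq, coeff_sub, coeff_X_mul, coeff_add, coeff_add, coeff_X_mul_derivative,
    coeff_C_mul, coeff_C_mul, coeff_derivative, h1, h2]
  ring

lemma natDegree_firstOrder_le (c d : ℝ) {s : ℝ[X]} {n : ℕ} (hs : s.natDegree ≤ n) :
    (firstOrder c d s).natDegree ≤ n + 1 := by
  rw [natDegree_le_iff_coeff_eq_zero]
  intro N hN
  obtain ⟨k, rfl⟩ : ∃ k, N = k + 1 := ⟨N - 1, by omega⟩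
  rw [coeff_firstOrder_succ c d (hs.trans (by omega : n ≤ k)),
    coeff_eq_zero_of_natDegree_lt (by omega), mul_zero]

end FirstOrder

section Orthogonal

variable {a b : ℝ}

/-- `φ` is the monic orthogonal polynomial of degree `n` for the Jacobi weight. -/
structure IsMonicJacobi (ha : -1 < a) (hb : -1 < b) (n : ℕ) (φ : ℝ[X]) : Prop where
  monic : φ.Monic
  natDegree_eq : φ.natDegree = n
  orthogonal : ∀ q : ℝ[X], q.degree < n → jacobiIntegral ha hb (φ * q) = 0

lemma degree_sub_C_coeff_mul_lt {φ q : ℝ[X]} {n : ℕ} (hφ : φ.Monic) (hn : φ.natDegree = n)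
    (hq : q.natDegree ≤ n) : (q - C (q.coeff n) * φ).degree < n := by
  rw [degree_lt_iff_coeff_zero]
  intro k hk
  rcases hk.eq_or_lt with rfl | hk
  · rw [coeff_sub, coeff_C_mul, ← hn, hφ.coeff_natDegree, mul_one, sub_self]
  · rw [coeff_sub, coeff_C_mul, coeff_eq_zero_of_natDegree_lt (hq.trans_lt hk),
      coeff_eq_zero_of_natDegree_lt (hn.trans_lt hk), mul_zero, sub_zero]

namespace IsMonicJacobi

variable {ha : -1 < a} {hb : -1 < b} {n : ℕ} {φ : ℝ[X]}

lemma integral_mul (h : IsMonicJacobi ha hb n φ) {q : ℝ[X]} (hq : q.natDegree ≤ n) :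
    jacobiIntegral ha hb (φ * q) = q.coeff n * jacobiIntegral ha hb (φ * φ) := by
  have h0 := h.orthogonal _ (degree_sub_C_coeff_mul_lt h.monic h.natDegree_eq hq)
  rw [mul_sub, map_sub, mul_left_comm, C_mul', map_smul, smul_eq_mul] at h0
  linarith

lemma integral_mul_firstOrder (h : IsMonicJacobi ha hb (n + 1) φ) (c d : ℝ) {s : ℝ[X]}
    (hs : s.natDegree ≤ n) :
    jacobiIntegral ha hb (φ * firstOrder c d s)
      = -(n + d) * s.coeff n * jacobiIntegral ha hb (φ * φ) := by
  rw [h.integral_mul (natDegree_firstOrder_le c d hs), coeff_firstOrder_succ c d hs]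

/-- The derivative of a Jacobi polynomial against the shifted weight, after integration by parts. -/
lemma integral_derivative_mul (h : IsMonicJacobi ha hb (n + 1) φ) {s : ℝ[X]}
    (hs : s.natDegree ≤ n) :
    jacobiIntegral (neg_one_lt_add_one ha) (neg_one_lt_add_one hb) (derivative φ * s)
      = (n + (a + b + 2)) * s.coeff n * jacobiIntegral ha hb (φ * φ) := by
  have h1 := jacobiIntegral_deriv ha hb (φ * s)
  have h2 := h.integral_mul_firstOrder (b - a) (a + b + 2) hs
  rw [show (1 - X ^ 2) * derivative (φ * s) + (C (b - a) - C (a + b + 2) * X) * (φ * s)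
      = (1 - X ^ 2) * (derivative φ * s) + φ * firstOrder (b - a) (a + b + 2) s by
    rw [derivative_mul, firstOrder]; ring, map_add, h2] at h1
  rw [jacobiIntegral_add_one ha hb]
  linarith

lemma coeff_derivative_self (h : IsMonicJacobi ha hb (n + 1) φ) :
    (derivative φ).coeff n = n + 1 := by
  rw [coeff_derivative, ← h.natDegree_eq, h.monic.coeff_natDegree, one_mul]

lemma natDegree_derivative_le (h : IsMonicJacobi ha hb (n + 1) φ) :
    (derivative φ).natDegree ≤ n := by
  have := Polynomial.natDegree_derivative_le φ
  rw [h.natDegree_eq] at this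
  simpa using this

lemma scaled_derivative (h : IsMonicJacobi ha hb (n + 1) φ) :
    IsMonicJacobi (neg_one_lt_add_one ha) (neg_one_lt_add_one hb) n
      (C ((n : ℝ) + 1)⁻¹ * derivative φ) := by
  have hn : (n : ℝ) + 1 ≠ 0 := by positivity
  have hdeg : (C ((n : ℝ) + 1)⁻¹ * derivative φ).natDegree ≤ n :=
    (natDegree_C_mul_le _ _).trans h.natDegree_derivative_le
  have hcoeff : (C ((n : ℝ) + 1)⁻¹ * derivative φ).coeff n = 1 := by
    rw [coeff_C_mul, h.coeff_derivative_self, inv_mul_cancel₀ hn]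
  refine ⟨monic_of_natDegree_le_of_coeff_eq_one n hdeg hcoeff,
    natDegree_eq_of_le_of_coeff_ne_zero hdeg (by rw [hcoeff]; exact one_ne_zero),
    fun q hq => ?_⟩
  rw [mul_assoc, C_mul', map_smul, h.integral_derivative_mul (natDegree_le_of_degree_le hq.le),
    coeff_eq_zero_of_degree_lt hq]
  simp

/-- Norms of Jacobi polynomials with shifted parameters. -/
lemma norm_succ (h : IsMonicJacobi ha hb (n + 1) φ) :
    jacobiIntegral ha hb (φ * φ) = (n + 1) / (n + (a + b + 2))
      * jacobiIntegral (neg_one_lt_add_one ha) (neg_one_lt_add_one hb)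
        ((C ((n : ℝ) + 1)⁻¹ * derivative φ)
          * (C ((n : ℝ) + 1)⁻¹ * derivative φ)) := by
  have hn : (n : ℝ) + 1 ≠ 0 := by positivity
  have hd : (n : ℝ) + (a + b + 2) ≠ 0 := by
    have : (0 : ℝ) ≤ n := n.cast_nonneg
    linarith
  have key := h.integral_derivative_mul h.natDegree_derivative_le
  rw [h.coeff_derivative_self] at key
  rw [mul_mul_mul_comm, ← C_mul, C_mul', map_smul, key, smul_eq_mul]
  field_simp

lemma norm_eq {n : ℕ} : ∀ {a b : ℝ} {ha : -1 < a} {hb : -1 < b} {φ : ℝ[X]},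
    IsMonicJacobi ha hb (n + 1) φ →
    (n + 1 + (a + b) / 2) * jacobiIntegral ha hb (φ * φ) = h4Jacobi a b n := by
  induction n with
  | zero =>
    intro a b ha hb φ h
    have h0 := h.scaled_derivative
    have h1 := eq_one_of_monic_natDegree_zero h0.monic h0.natDegree_eq
    rw [h.norm_succ, h1, mul_one, jacobiIntegral_one, h4Jacobi]
    have hs : 0 < a + b + 2 := by linarith
    have g1 := Real.Gamma_pos_of_pos hs
    have g2 : 0 < Real.Gamma (a + b + 4) := Real.Gamma_pos_of_pos (by linarith)
    have e : Real.Gamma 2 = 1 := Real.Gamma_two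
    simp only [Nat.cast_zero, zero_add, mul_zero, add_zero, e]
    rw [show a + 1 + (b + 1) + 1 = a + b + 1 + 2 by ring,
      show a + 1 + (b + 1) + 2 = a + b + 4 by ring, show a + 1 + 1 = a + 2 by ring,
      show b + 1 + 1 = b + 2 by ring, show a + b + 1 + 2 = a + b + 2 + 1 by ring,
      Real.rpow_add_one two_ne_zero]
    field_simp
    ring
  | succ n ih =>
    intro a b ha hb φ h
    have h0 := ih h.scaled_derivative
    have hn : (0 : ℝ) ≤ n := n.cast_nonneg
    rw [h.norm_succ]
    push_cast at h0 ⊢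
    have hs : 0 < (n : ℝ) + a + b + 3 := by linarith
    have hr : (n : ℝ) + 1 + (a + 1 + (b + 1)) / 2 = n + 1 + 1 + (a + b) / 2 := by ring
    rw [hr] at h0
    rw [mul_left_comm, h0, h4Jacobi, h4Jacobi]
    rw [show a + 1 + (b + 1) + 2 * (n : ℝ) + 2 = a + b + 2 * (n + 1) + 2 by ring,
      show (n : ℝ) + (a + 1) + 2 = n + 1 + a + 2 by ring,
      show (n : ℝ) + (b + 1) + 2 = n + 1 + b + 2 by ring,
      show (n : ℝ) + (a + 1) + (b + 1) + 2 = n + a + b + 3 + 1 by ring,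
      show 2 * (n : ℝ) + (a + 1) + (b + 1) + 2 = 2 * (n + 1) + a + b + 2 by ring,
      show 2 * (n : ℝ) + (a + 1) + (b + 1) + 4 = 2 * (n + 1) + a + b + 4 by ring,
      show (n : ℝ) + 1 + 2 = n + 2 + 1 by ring,
      show (n : ℝ) + 1 + a + b + 2 = n + a + b + 3 by ring,
      Real.Gamma_add_one hs.ne', Real.Gamma_add_one (by linarith : (n : ℝ) + 2 ≠ 0),
      show (n : ℝ) + 1 + (a + b + 2) = n + a + b + 3 by ring]
    field_simp
    ring

end IsMonicJacobi

/-- The skew inner product of a Jacobi polynomial with a polynomial of lower degree. -/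
lemma IsMonicJacobi.skew {ha : -1 < a} {hb : -1 < b} {n : ℕ} {φ : ℝ[X]}
    (h : IsMonicJacobi ha hb (n + 1) φ) {s : ℝ[X]} (hs : s.natDegree ≤ n) :
    1 / 2 * jacobiIntegral (neg_one_lt_add_one ha) (neg_one_lt_add_one hb)
        (φ * derivative s - derivative φ * s)
      = -(s.coeff n * h4Jacobi a b n) := by
  have h1 := jacobiIntegral_deriv ha hb (φ * s)
  have h2 := h.integral_mul_firstOrder ((b - a) / 2) ((a + b + 2) / 2) hs
  have e1 : (C (b - a) : ℝ[X]) = 2 * C ((b - a) / 2) := by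
    rw [← C_ofNat, ← C_mul]; congr 1; ring
  have e2 : (C (a + b + 2) : ℝ[X]) = 2 * C ((a + b + 2) / 2) := by
    rw [← C_ofNat, ← C_mul]; congr 1; ring
  have e : (1 - X ^ 2) * (φ * derivative s - derivative φ * s)
      = (2 : ℝ) • (φ * firstOrder ((b - a) / 2) ((a + b + 2) / 2) s)
        - ((1 - X ^ 2) * derivative (φ * s)
          + (C (b - a) - C (a + b + 2) * X) * (φ * s)) := by
    rw [← C_mul', C_ofNat, derivative_mul, firstOrder, e1, e2]; ring
  rw [jacobiIntegral_add_one ha hb, e, map_sub, h1, map_smul, h2, ← h.norm_eq, smul_eq_mul]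
  ring

/-- Pairwise orthogonal monic polynomials of all degrees are Jacobi polynomials. -/
lemma isMonicJacobi_of_pairwise (ha : -1 < a) (hb : -1 < b) {p : ℕ → ℝ[X]}
    (hmonic : ∀ n, (p n).Monic) (hdeg : ∀ n, (p n).natDegree = n)
    (horth : ∀ n m, n ≠ m → jacobiIntegral ha hb (p n * p m) = 0) (n : ℕ) :
    IsMonicJacobi ha hb n (p n) := by
  refine ⟨hmonic n, hdeg n, fun q hq => ?_⟩
  suffices H : ∀ k ≤ n, ∀ q : ℝ[X], q.degree < k → jacobiIntegral ha hb (p n * q) = 0 from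
    H n le_rfl q hq
  intro k
  induction k with
  | zero =>
    intro _ q hq
    rw [degree_lt_iff_coeff_zero] at hq
    simp [show q = 0 from ext fun i => by simpa using hq i i.zero_le]
  | succ k ih =>
    intro hk q hq
    have hq' : q.natDegree ≤ k := natDegree_le_iff_coeff_eq_zero.2 fun N hN =>
      (degree_lt_iff_coeff_zero _ _).1 hq N hN
    have h0 := ih (by omega) _ (degree_sub_C_coeff_mul_lt (hmonic k) (hdeg k) hq')
    rw [mul_sub, map_sub, mul_left_comm, C_mul', map_smul, horth n k (by omega), smul_zero,
      sub_zero] at h0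
    exact h0

end Orthogonal

/-- **Jacobi case, β = 4 pairing**: for the monic Jacobi polynomials `p_n^{(a,b)}`,
`⟨p_{2m}^{(a,b)}, p_{2n+1}^{(a,b)}⟩_4 = h4_{2n} δ_{n,m} - h4_{2m-1} δ_{m-1,n}`,
where the β = 4 skew inner product has weight `(1-z)^{a+1}(1+z)^{b+1}` on `(-1,1)`. -/
theorem statement12 (a b : ℝ) (ha : -1 < a) (hb : -1 < b)
    (p : ℤ → Polynomial ℝ) (hpneg : p (-1) = 0)
    (hmonic : ∀ n : ℕ, (p n).Monic) (hdeg : ∀ n : ℕ, (p n).natDegree = n)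
    (horth : ∀ n m : ℕ, n ≠ m →
      ∫ z in Set.Ioo (-1 : ℝ) 1,
        (p n).eval z * (p m).eval z * (1 - z) ^ a * (1 + z) ^ b = 0) :
    ∀ m n : ℕ,
      (1 / 2 : ℝ) * ∫ z in Set.Ioo (-1 : ℝ) 1,
          ((p (2 * m)).eval z * (Polynomial.derivative (p (2 * n + 1))).eval z
            - (Polynomial.derivative (p (2 * m))).eval z * (p (2 * n + 1)).eval z)
          * (1 - z) ^ (a + 1) * (1 + z) ^ (b + 1)
        = (if n = m then h4Jacobi a b (2 * (n : ℝ)) else 0)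
          - (if (m : ℤ) - 1 = (n : ℤ) then h4Jacobi a b (2 * (m : ℝ) - 1) else 0) := by
  intro m n
  have hJ := isMonicJacobi_of_pairwise ha hb (p := fun k : ℕ => p k) hmonic hdeg fun i j hij => by
    rw [← horth i j hij, jacobiIntegral_apply]
    simp only [eval_mul, mul_assoc]
  have hskew : (1 / 2 : ℝ) * ∫ z in Set.Ioo (-1 : ℝ) 1,
      ((p (2 * m)).eval z * (Polynomial.derivative (p (2 * n + 1))).eval z
        - (Polynomial.derivative (p (2 * m))).eval z * (p (2 * n + 1)).eval z)
      * (1 - z) ^ (a + 1) * (1 + z) ^ (b + 1)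
      = 1 / 2 * jacobiIntegral (neg_one_lt_add_one ha) (neg_one_lt_add_one hb)
        (p (2 * m) * Polynomial.derivative (p (2 * n + 1))
          - Polynomial.derivative (p (2 * m)) * p (2 * n + 1)) := by
    simp only [jacobiIntegral_apply, eval_sub, eval_mul, mul_assoc]
  rw [hskew]
  have h1 : p (2 * m) = p ((2 * m : ℕ) : ℤ) := by push_cast; rfl
  have h2 : p (2 * n + 1) = p ((2 * n + 1 : ℕ) : ℤ) := by push_cast; rfl
  have d1 := hdeg (2 * m)
  have d2 := hdeg (2 * n + 1)
  have c1 := (hmonic (2 * m)).coeff_natDegree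
  have c2 := (hmonic (2 * n + 1)).coeff_natDegree
  rw [d1] at c1
  rw [d2] at c2
  rw [h1, h2]
  rcases le_or_gt m n with hmn | hmn
  · have key := (hJ (2 * n + 1)).skew (s := p ((2 * m : ℕ) : ℤ)) (n := 2 * n) (by omega)
    rw [if_neg (by omega : ¬ (m : ℤ) - 1 = n), sub_zero, ← neg_inj, ← mul_neg, ← map_neg, neg_sub,
      mul_comm (Polynomial.derivative _), mul_comm (p ((2 * m : ℕ) : ℤ)), key]
    split_ifs with h
    · subst h
      rw [c1]; push_cast; ring
    · rw [coeff_eq_zero_of_natDegree_lt (by omega)]; ring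
  · obtain ⟨k, rfl⟩ : ∃ k, m = k + 1 := ⟨m - 1, by omega⟩
    have key := (hJ (2 * (k + 1))).skew (s := p ((2 * n + 1 : ℕ) : ℤ)) (n := 2 * k + 1) (by omega)
    rw [if_neg (by omega : ¬ n = k + 1), zero_sub, key]
    split_ifs with h
    · obtain rfl : k = n := by omega
      rw [c2]; push_cast; ring_nf
    · rw [coeff_eq_zero_of_natDegree_lt (by omega)]; ring
end

section
/- Let a, b > −1 and define the Jacobi data ζ_k = 8k(2k+a)(2k+b)(2k+a+b) / [(4k+a+b−1)(4k+a+b)(4k+a+b+1)(4k+a+b+2)] and h4_j = 2^{a+b+2j+2} Γ(j+2)Γ(j+a+2)Γ(j+b+2)Γ(j+a+b+2) / [Γ(2j+a+b+2)Γ(2j+a+b+4)]. Then (i) for every j ≥ 1, c_j := ∏_{k=1}^{j} ζ_k h4_{2k−2}/h4_{2k−1} = (a+b+2)/(4j+a+b+2); and (ii) consequently, for any X ∈ ℝ and any h1_j, if the sequences {α_j} and {ξ_j} satisfy h4_{2j+1} α_{j+1} − (X² h1_j + h4_{2j} + ζ_j h4_{2j−1}) α_j + ζ_j h4_{2j−2}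 α_{j−1} = 0 and ζ_{j+1} h4_{2j} ξ_{j+1} − (X² h1_j + h4_{2j} + ζ_j h4_{2j−1}) ξ_j + h4_{2j−1} ξ_{j−1} = 0 for all j ≥ 0, with α_{−1} = ξ_{−1} = 0 and α_0 = ξ_0 = 1 (and ζ_0 = 0, h4_{−1} := 0), then ξ_j = ((4j+a+b+2)/(a+b+2)) α_j for every j ≥ 0. -/
open Finset

/-- The Jacobi norm `h4` at a real argument `x`. -/
noncomputable def jacobiNorm (a b x : ℝ) : ℝ :=
  (2 : ℝ) ^ (a + b + 2 * x + 2) * Real.Gamma (x + 2) * Real.Gamma (x + a + 2)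
    * Real.Gamma (x + b + 2) * Real.Gamma (x + a + b + 2)
    / (Real.Gamma (2 * x + a + b + 2) * Real.Gamma (2 * x + a + b + 4))

lemma jacobiNorm_pos {a b x : ℝ} (ha : -1 < a) (hb : -1 < b) (hx : 0 ≤ x) :
    0 < jacobiNorm a b x := by
  have h1 := Real.Gamma_pos_of_pos (show 0 < x + 2 by linarith)
  have h2 := Real.Gamma_pos_of_pos (show 0 < x + a + 2 by linarith)
  have h3 := Real.Gamma_pos_of_pos (show 0 < x + b + 2 by linarith)
  have h4 := Real.Gamma_pos_of_pos (show 0 < x + a + b + 2 by linarith)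
  have h5 := Real.Gamma_pos_of_pos (show 0 < 2 * x + a + b + 2 by linarith)
  have h6 := Real.Gamma_pos_of_pos (show 0 < 2 * x + a + b + 4 by linarith)
  unfold jacobiNorm
  positivity

lemma Gamma_add_two {x : ℝ} (hx : 0 < x) :
    Real.Gamma (x + 2) = (x + 1) * x * Real.Gamma x := by
  rw [show x + 2 = x + 1 + 1 by ring, Real.Gamma_add_one (by positivity),
    Real.Gamma_add_one hx.ne', mul_assoc]

lemma jacobiNorm_add_one {a b x : ℝ} (ha : -1 < a) (hb : -1 < b) (hx : 0 ≤ x) :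
    jacobiNorm a b (x + 1) = jacobiNorm a b x
      * (4 * (x + 2) * (x + a + 2) * (x + b + 2) * (x + a + b + 2)
        / ((2 * x + a + b + 2) * (2 * x + a + b + 3) * (2 * x + a + b + 4)
          * (2 * x + a + b + 5))) := by
  have p1 : 0 < x + 2 := by linarith
  have p2 : 0 < x + a + 2 := by linarith
  have p3 : 0 < x + b + 2 := by linarith
  have p4 : 0 < x + a + b + 2 := by linarith
  have p5 : 0 < 2 * x + a + b + 2 := by linarith
  have p6 : 0 < 2 * x + a + b + 4 := by linarith
  have p7 : 0 < 2 * x + a + b + 3 := by linarith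
  have p8 : 0 < 2 * x + a + b + 5 := by linarith
  have g5 := (Real.Gamma_pos_of_pos p5).ne'
  have g6 := (Real.Gamma_pos_of_pos p6).ne'
  have e0 : (2 : ℝ) ^ (a + b + 2 * (x + 1) + 2) = 2 ^ (a + b + 2 * x + 2) * 4 := by
    rw [show a + b + 2 * (x + 1) + 2 = a + b + 2 * x + 2 + 2 by ring,
      Real.rpow_add two_pos (a + b + 2 * x + 2) 2]
    norm_num
  unfold jacobiNorm
  rw [e0, show x + 1 + 2 = x + 2 + 1 by ring, Real.Gamma_add_one p1.ne',
    show x + 1 + a + 2 = x + a + 2 + 1 by ring, Real.Gamma_add_one p2.ne',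
    show x + 1 + b + 2 = x + b + 2 + 1 by ring, Real.Gamma_add_one p3.ne',
    show x + 1 + a + b + 2 = x + a + b + 2 + 1 by ring, Real.Gamma_add_one p4.ne',
    show 2 * (x + 1) + a + b + 2 = 2 * x + a + b + 2 + 2 by ring, Gamma_add_two p5,
    show 2 * (x + 1) + a + b + 4 = 2 * x + a + b + 4 + 2 by ring, Gamma_add_two p6,
    show 2 * x + a + b + 2 + 1 = 2 * x + a + b + 3 by ring,
    show 2 * x + a + b + 4 + 1 = 2 * x + a + b + 5 by ring]
  field_simp

/-- The ratio of consecutive norms in terms of the Jacobi coefficient `ζ_{x + 1}`. -/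
lemma jacobi_coeff_mul_jacobiNorm {a b x : ℝ} (ha : -1 < a) (hb : -1 < b) (hx : 0 ≤ x) :
    8 * (x + 1) * (2 * (x + 1) + a) * (2 * (x + 1) + b) * (2 * (x + 1) + a + b)
        / ((4 * (x + 1) + a + b - 1) * (4 * (x + 1) + a + b) * (4 * (x + 1) + a + b + 1)
          * (4 * (x + 1) + a + b + 2)) * jacobiNorm a b (2 * x)
      = (4 * x + a + b + 2) / (4 * (x + 1) + a + b + 2) * jacobiNorm a b (2 * x + 1) := by
  rw [jacobiNorm_add_one ha hb (by positivity),
    show 2 * (2 * x) + a + b + 2 = 4 * x + a + b + 2 by ring,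
    show 2 * (2 * x) + a + b + 3 = 4 * (x + 1) + a + b - 1 by ring,
    show 2 * (2 * x) + a + b + 4 = 4 * (x + 1) + a + b by ring,
    show 2 * (2 * x) + a + b + 5 = 4 * (x + 1) + a + b + 1 by ring]
  have p0 : 4 * x + a + b + 2 ≠ 0 := by apply ne_of_gt; linarith
  have p1 : 4 * (x + 1) + a + b - 1 ≠ 0 := by apply ne_of_gt; linarith
  have p2 : 4 * (x + 1) + a + b ≠ 0 := by apply ne_of_gt; linarith
  have p3 : 4 * (x + 1) + a + b + 1 ≠ 0 := by apply ne_of_gt; linarith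
  have p4 : 4 * (x + 1) + a + b + 2 ≠ 0 := by apply ne_of_gt; linarith
  generalize 4 * x + a + b + 2 = d₀ at *
  generalize 4 * (x + 1) + a + b - 1 = d₁ at *
  generalize 4 * (x + 1) + a + b + 1 = d₃ at *
  generalize 4 * (x + 1) + a + b + 2 = d₄ at *
  generalize 4 * (x + 1) + a + b = d₂ at *
  field_simp
  ring

/-- **Jacobi case, coupling constant**: with the Jacobi data `ζ_k`, `h4_j`, the products
`c_j = Π_{k=1}^{j} ζ_k h4_{2k-2}/h4_{2k-1}` equal `(a+b+2)/(4j+a+b+2)`, and consequently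
the solutions of the coupled recurrences satisfy `ξ_j = ((4j+a+b+2)/(a+b+2)) α_j`. -/
theorem statement14 (a b : ℝ) (ha : -1 < a) (hb : -1 < b)
    (ζ : ℕ → ℝ)
    (hζ : ∀ k : ℕ, ζ k = 8 * (k : ℝ) * (2 * (k : ℝ) + a) * (2 * (k : ℝ) + b)
        * (2 * (k : ℝ) + a + b)
        / ((4 * (k : ℝ) + a + b - 1) * (4 * (k : ℝ) + a + b) * (4 * (k : ℝ) + a + b + 1)
          * (4 * (k : ℝ) + a + b + 2)))
    (h4 : ℤ → ℝ)
    (hh4 : ∀ j : ℕ, h4 j = (2 : ℝ) ^ (a + b + 2 * (j : ℝ) + 2)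
        * Real.Gamma ((j : ℝ) + 2) * Real.Gamma ((j : ℝ) + a + 2)
        * Real.Gamma ((j : ℝ) + b + 2) * Real.Gamma ((j : ℝ) + a + b + 2)
        / (Real.Gamma (2 * (j : ℝ) + a + b + 2) * Real.Gamma (2 * (j : ℝ) + a + b + 4)))
    (hh4neg : h4 (-1) = 0) :
    (∀ j : ℕ, 1 ≤ j →
      ∏ k ∈ Finset.Icc 1 j, ζ k * h4 (2 * k - 2) / h4 (2 * k - 1)
        = (a + b + 2) / (4 * (j : ℝ) + a + b + 2)) ∧
    (∀ (X : ℝ) (h1 : ℕ → ℝ) (α ξ : ℤ → ℝ),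
      (∀ j : ℕ, h4 (2 * j + 1) * α (j + 1)
          - (X ^ 2 * h1 j + h4 (2 * j) + ζ j * h4 (2 * j - 1)) * α j
          + ζ j * h4 (2 * j - 2) * α ((j : ℤ) - 1) = 0) →
      (∀ j : ℕ, ζ (j + 1) * h4 (2 * j) * ξ (j + 1)
          - (X ^ 2 * h1 j + h4 (2 * j) + ζ j * h4 (2 * j - 1)) * ξ j
          + h4 (2 * j - 1) * ξ ((j : ℤ) - 1) = 0) →
      α (-1) = 0 → ξ (-1) = 0 → α 0 = 1 → ξ 0 = 1 →
      ∀ j : ℕ, ξ j = (4 * (j : ℝ) + a + b + 2) / (a + b + 2) * α j) := by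
  have hs : 0 < a + b + 2 := by linarith
  have hd (j : ℕ) : 0 < 4 * (j : ℝ) + a + b + 2 := by
    have : (0 : ℝ) ≤ j := j.cast_nonneg
    linarith
  have hd' (j : ℕ) : 0 < 4 * ((j : ℝ) + 1) + a + b + 2 := by linarith [hd j]
  have heven (j : ℕ) : h4 (2 * j) = jacobiNorm a b (2 * (j : ℝ)) := by
    have h := hh4 (2 * j)
    push_cast at h
    exact h
  have hodd (j : ℕ) : h4 (2 * j + 1) = jacobiNorm a b (2 * (j : ℝ) + 1) := by
    have h := hh4 (2 * j + 1)
    push_cast at h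
    exact h
  have hne (j : ℕ) : h4 (2 * j + 1) ≠ 0 := by
    rw [hodd]
    exact (jacobiNorm_pos ha hb (by positivity)).ne'
  have key (j : ℕ) : ζ (j + 1) * h4 (2 * j)
      = (4 * (j : ℝ) + a + b + 2) / (4 * ((j : ℝ) + 1) + a + b + 2) * h4 (2 * j + 1) := by
    rw [hζ, hodd, heven]
    push_cast
    exact jacobi_coeff_mul_jacobiNorm ha hb j.cast_nonneg
  refine ⟨fun j _ ↦ ?_, fun X h1 α ξ hα hξ hα' _ hα0 hξ0 ↦ ?_⟩
  · clear * - hs hd hd' hne key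
    induction j with
    | zero => simp [hs.ne']
    | succ j ih =>
      rw [Finset.prod_Icc_succ_top (by omega), ih]
      push_cast
      rw [show 2 * ((j : ℤ) + 1) - 2 = 2 * j by ring,
        show 2 * ((j : ℤ) + 1) - 1 = 2 * j + 1 by ring, key]
      have := (hd j).ne'
      have := (hd' j).ne'
      have := hne j
      field_simp
  · -- Cancelling the common middle term of the two recurrences.
    have step (j : ℕ) (hj : ξ j = (4 * (j : ℝ) + a + b + 2) / (a + b + 2) * α j)
        (hprev : h4 (2 * j - 1) * ξ ((j : ℤ) - 1)
          = (4 * (j : ℝ) + a + b + 2) / (a + b + 2)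
            * (ζ j * h4 (2 * j - 2) * α ((j : ℤ) - 1))) :
        ξ (j + 1) = (4 * ((j : ℝ) + 1) + a + b + 2) / (a + b + 2) * α (j + 1) := by
      have h := hξ j
      rw [key, hj, hprev] at h
      have := (hd j).ne'
      have := (hd' j).ne'
      have e : (4 * (j : ℝ) + a + b + 2) / (4 * ((j : ℝ) + 1) + a + b + 2) * h4 (2 * j + 1)
          * ξ (j + 1) = (4 * (j : ℝ) + a + b + 2) / (a + b + 2)
            * (h4 (2 * j + 1) * α (j + 1)) := by
        linear_combination h - (4 * (j : ℝ) + a + b + 2) / (a + b + 2) * hα j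
      have := hne j
      field_simp at e ⊢
      linear_combination e
    intro j
    induction j using Nat.strong_induction_on with
    | _ j ih =>
      match j with
      | 0 => simp [hα0, hξ0, hs.ne']
      | 1 =>
        have h := step 0 (ih 0 one_pos) (by simp [hh4neg, hα'])
        simpa using h
      | j + 2 =>
        have h := step (j + 1) (ih (j + 1) (by omega)) (by
          push_cast
          rw [show (j : ℤ) + 1 - 1 = j by ring, show 2 * ((j : ℤ) + 1) - 2 = 2 * j by ring,
            show 2 * ((j : ℤ) + 1) - 1 = 2 * j + 1 by ring, key, ih j (by omega)]
          have := (hd' j).ne'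
          field_simp)
        push_cast at h ⊢
        rw [show (j : ℤ) + 2 = j + 1 + 1 by ring, h]
        ring
end

section
/- Fix X ∈ ℝ and p, q ∈ ℝ with 2p ∉ ℤ, and set c = −p + iq, c̄ = −p − iq. Let {α_j}_{j≥−1} be the real sequence determined by α_{−1} = 0, α_0 = 1 and, for all j ≥ 0, [X² + (2j+1)(2p−2j−1)((p−2j−1)² + q²) / ((2p−4j−1)(2p−4j−3)) + 2j(2p−2j)((p−2j)² + q²) / ((2p−4j−1)(2p−4j+1))] α_j = 4 (2j+1)(2j+2)(2p−2j−2)(2p−2j−1)((p−2j−2)² + q²)((p−2j−1)² + q²) / [(2p−4j−5)(2p−4j−4)(2p−4j−3)²(2p−4j−2)(2p−4j−1)] · α_{j+1} + (1/4)(2p−4j)(2p−4j+2) α_{j−1}, where for j = 0 the term containing the factor 2j and the term involving α_{j−1} are both interpreted as 0. Then for every j ≥ 0, α_j = (−1)^j 2^{−2j} · [Γ(p−iq−2j) Γ(2p−1)] / [Γ(2j+1) Γ(2p−4j−1) Γ(p−iq)] · Σ_{k=0}^{j} [(−j)_k (j−p+1/2)_k ((1−p−iq+iX)/2)_k ((1−p−iq−iX)/2)_k]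 / [(1−p)_k ((2−p−iq)/2)_k ((1−p−iq)/2)_k · k!], i.e. the terminating series is the ₄F₃-normalised Wilson polynomial W̃_j(X²/4; (c̄+1)/2, (c+1)/2, 1/2, 0); in particular the right-hand side is real. -/
open Finset

section Wilson

variable {K : Type*} [Field K]

/-- The coefficient of `(a + x)_k (a - x)_k` in the `₄F₃`-normalised Wilson function of degree
`ν` with parameters `a, b, c, d`. -/
noncomputable def wilsonCoeff (a b c d ν : K) (k : ℕ) : K :=
  (ascPochhammer K k).eval (-ν) * (ascPochhammer K k).eval (ν + (a + b + c + d - 1))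
    / ((ascPochhammer K k).eval (a + b) * (ascPochhammer K k).eval (a + c)
      * (ascPochhammer K k).eval (a + d) * (Nat.factorial k : K))

/-- The first `N` terms of the `₄F₃`-normalised Wilson function of degree `ν`, evaluated at
`-x ^ 2`. -/
noncomputable def wilsonPartialSum (a b c d x ν : K) (N : ℕ) : K :=
  ∑ k ∈ range N, wilsonCoeff a b c d ν k
    * ((ascPochhammer K k).eval (a + x) * (ascPochhammer K k).eval (a - x))

/-- The coefficient of the degree `ν + 1` term in the Wilson recurrence. -/
noncomputable def wilsonUp (a b c d ν : K) : K :=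
  (ν + (a + b + c + d - 1)) * (ν + a + b) * (ν + a + c) * (ν + a + d)
    / ((2 * ν + (a + b + c + d - 1)) * (2 * ν + (a + b + c + d)))

/-- The coefficient of the degree `ν - 1` term in the Wilson recurrence. -/
noncomputable def wilsonDown (a b c d ν : K) : K :=
  ν * (ν + b + c - 1) * (ν + b + d - 1) * (ν + c + d - 1)
    / ((2 * ν + (a + b + c + d - 2)) * (2 * ν + (a + b + c + d - 1)))

theorem ascPochhammer_eval_succ_left (x : K) (k : ℕ) :
    (ascPochhammer K (k + 1)).eval x = x * (ascPochhammer K k).eval (x + 1) := by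
  simp [ascPochhammer_succ_left]

theorem ascPochhammer_eval_ne_zero {x : K} (hx : ∀ m : ℕ, x + m ≠ 0) (k : ℕ) :
    (ascPochhammer K k).eval x ≠ 0 := by
  induction k with
  | zero => simp
  | succ k ih => rw [ascPochhammer_succ_eval]; exact mul_ne_zero ih (hx k)

theorem wilsonCoeff_zero (a b c d ν : K) : wilsonCoeff a b c d ν 0 = 1 := by
  simp [wilsonCoeff]

theorem wilsonCoeff_recurrence [CharZero K] {a b c d ν : K}
    (hab : ∀ m : ℕ, a + b + m ≠ 0) (hac : ∀ m : ℕ, a + c + m ≠ 0)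
    (had : ∀ m : ℕ, a + d + m ≠ 0) (h₀ : 2 * ν + (a + b + c + d - 2) ≠ 0)
    (h₁ : 2 * ν + (a + b + c + d - 1) ≠ 0) (h₂ : 2 * ν + (a + b + c + d) ≠ 0) (k : ℕ) :
    wilsonUp a b c d ν * wilsonCoeff a b c d (ν + 1) (k + 1)
      - (wilsonUp a b c d ν + wilsonDown a b c d ν) * wilsonCoeff a b c d ν (k + 1)
      + wilsonDown a b c d ν * wilsonCoeff a b c d (ν - 1) (k + 1)
    = (k + 1) * (k + 1 + 2 * a) * wilsonCoeff a b c d ν (k + 1)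
      - wilsonCoeff a b c d ν k := by
  set s := a + b + c + d - 1 with hs
  set P := (ascPochhammer K k).eval (-ν) with hP
  set Q := (ascPochhammer K k).eval (ν + s) with hQ
  have e₁ : (ascPochhammer K (k + 1)).eval (-(ν + 1)) = -(ν + 1) * P := by
    rw [ascPochhammer_eval_succ_left, hP]; congr 3; ring
  have e₂ : (ascPochhammer K (k + 1)).eval (-ν) = P * (-ν + k) := ascPochhammer_succ_eval ..
  have e₃ : ν * (ascPochhammer K (k + 1)).eval (-(ν - 1)) = -(P * (-ν + k) * (-ν + k + 1)) := by
    have h := ascPochhammer_eval_succ_left (-ν) (k + 1)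
    rw [ascPochhammer_succ_eval, e₂, show -ν + 1 = -(ν - 1) by ring] at h
    push_cast at h
    linear_combination h
  have f₁ : (ν + s) * (ascPochhammer K (k + 1)).eval (ν + 1 + s)
      = Q * (ν + s + k) * (ν + s + k + 1) := by
    have h := ascPochhammer_eval_succ_left (ν + s) (k + 1)
    rw [ascPochhammer_succ_eval, ascPochhammer_succ_eval,
      show ν + s + 1 = ν + 1 + s by ring] at h
    push_cast at h
    linear_combination -h
  have f₂ : (ascPochhammer K (k + 1)).eval (ν + s) = Q * (ν + s + k) :=
    ascPochhammer_succ_eval ..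
  have f₃ : (ascPochhammer K (k + 1)).eval (ν - 1 + s) = (ν - 1 + s) * Q := by
    rw [ascPochhammer_eval_succ_left, hQ, show ν - 1 + s + 1 = ν + s by ring]
  have hF := ascPochhammer_eval_ne_zero hab k
  have hG := ascPochhammer_eval_ne_zero hac k
  have hH := ascPochhammer_eval_ne_zero had k
  have hk : (Nat.factorial k : K) ≠ 0 := by exact_mod_cast Nat.factorial_ne_zero k
  have hk1 : (k : K) + 1 ≠ 0 := by exact_mod_cast k.succ_ne_zero
  have hfk := hab k
  have hgk := hac k
  have hhk := had k
  have up : wilsonUp a b c d ν * wilsonCoeff a b c d (ν + 1) (k + 1)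
      = ((ν + a + b) * (ν + a + c) * (ν + a + d)
          / ((2 * ν + s) * (2 * ν + (a + b + c + d))))
        * (-(ν + 1) * P * (Q * (ν + s + k) * (ν + s + k + 1)))
        / ((ascPochhammer K (k + 1)).eval (a + b) * (ascPochhammer K (k + 1)).eval (a + c)
          * (ascPochhammer K (k + 1)).eval (a + d) * (Nat.factorial (k + 1) : K)) := by
    rw [← f₁, ← e₁, wilsonUp, wilsonCoeff, ← hs]; ring
  have down : wilsonDown a b c d ν * wilsonCoeff a b c d (ν - 1) (k + 1)
      = ((ν + b + c - 1) * (ν + b + d - 1) * (ν + c + d - 1)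
          / ((2 * ν + (a + b + c + d - 2)) * (2 * ν + s)))
        * (-(P * (-ν + k) * (-ν + k + 1)) * ((ν - 1 + s) * Q))
        / ((ascPochhammer K (k + 1)).eval (a + b) * (ascPochhammer K (k + 1)).eval (a + c)
          * (ascPochhammer K (k + 1)).eval (a + d) * (Nat.factorial (k + 1) : K)) := by
    rw [← f₃, ← e₃, wilsonDown, wilsonCoeff, ← hs]; ring
  rw [up, down, wilsonUp, wilsonDown, wilsonCoeff, wilsonCoeff, ← hs, e₂, f₂, ← hP, ← hQ]
  simp only [ascPochhammer_succ_eval, Nat.factorial_succ, Nat.cast_mul, Nat.cast_succ]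
  clear_value P Q
  generalize (ascPochhammer K k).eval (a + b) = F at *
  generalize (ascPochhammer K k).eval (a + c) = G at *
  generalize (ascPochhammer K k).eval (a + d) = H at *
  generalize (Nat.factorial k : K) = φ at *
  generalize (k : K) = κ at *
  have key : -(ν + s + κ) * ((ν + a + b) * (ν + a + c) * (ν + a + d))
      - (κ - ν) * ((ν + b + c - 1) * (ν + b + d - 1) * (ν + c + d - 1))
      = (2 * ν + s) * ((κ + 1 + 2 * a) * (κ - ν) * (ν + s + κ)
        - (a + b + κ) * (a + c + κ) * (a + d + κ)) := by
    rw [hs]; ring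
  have hd₀ : 2 * ν + (a + b + c + d - 2) = 2 * ν + s - 1 := by rw [hs]; ring
  have hd₂ : 2 * ν + (a + b + c + d) = 2 * ν + s + 1 := by rw [hs]; ring
  rw [hd₀] at h₀ ⊢
  rw [hd₂] at h₂ ⊢
  rw [mul_assoc (ν + s), mul_assoc (ν + s), mul_assoc ν, mul_assoc ν]
  generalize (ν + a + b) * (ν + a + c) * (ν + a + d) = U at *
  generalize (ν + b + c - 1) * (ν + b + d - 1) * (ν + c + d - 1) = V at *
  generalize a + b + κ = f at *
  generalize a + c + κ = g at *
  generalize a + d + κ = h at *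
  clear_value s
  clear e₁ e₂ e₃ f₁ f₂ f₃ up down hP hQ hab hac had hs hd₀ hd₂
  obtain ⟨D, hD⟩ : ∃ D, D = 2 * ν + s := ⟨_, rfl⟩
  rw [← hD] at h₀ h₁ h₂ key ⊢
  have upper : U / (D * (D + 1)) * (-(ν + 1) * ((ν + s + κ) * (ν + s + κ + 1)))
      - (ν + s) * U / (D * (D + 1)) * ((-ν + κ) * (ν + s + κ))
      = -(κ + 1) * (ν + s + κ) * U / D := by
    field_simp
    rw [hD]
    ring
  have lower : V / ((D - 1) * D) * (-((-ν + κ) * (-ν + κ + 1)) * (ν - 1 + s))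
      - ν * V / ((D - 1) * D) * ((-ν + κ) * (ν + s + κ))
      = -(κ + 1) * (κ - ν) * V / D := by
    field_simp
    rw [hD]
    ring
  have total : -(κ + 1) * (ν + s + κ) * U / D + -(κ + 1) * (κ - ν) * V / D
      = (κ + 1) * ((κ + 1 + 2 * a) * (κ - ν) * (ν + s + κ) - f * g * h) := by
    field_simp
    linear_combination key
  have last : P * Q / (F * G * H * φ)
      = (κ + 1) * (f * g * h) * (P * Q) / (F * f * (G * g) * (H * h) * ((κ + 1) * φ)) := by
    field_simp
  rw [last]
  linear_combination (P * Q) / (F * f * (G * g) * (H * h) * ((κ + 1) * φ))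
    * (upper + lower + total)

theorem wilsonPartialSum_recurrence [CharZero K] {a b c d ν : K} (x : K)
    (hab : ∀ m : ℕ, a + b + m ≠ 0) (hac : ∀ m : ℕ, a + c + m ≠ 0)
    (had : ∀ m : ℕ, a + d + m ≠ 0) (h₀ : 2 * ν + (a + b + c + d - 2) ≠ 0)
    (h₁ : 2 * ν + (a + b + c + d - 1) ≠ 0) (h₂ : 2 * ν + (a + b + c + d) ≠ 0) (N : ℕ) :
    wilsonUp a b c d ν * wilsonPartialSum a b c d x (ν + 1) (N + 1)
      - (wilsonUp a b c d ν + wilsonDown a b c d ν - (a ^ 2 - x ^ 2))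
        * wilsonPartialSum a b c d x ν (N + 1)
      + wilsonDown a b c d ν * wilsonPartialSum a b c d x (ν - 1) (N + 1)
    = wilsonCoeff a b c d ν N
      * ((ascPochhammer K (N + 1)).eval (a + x) * (ascPochhammer K (N + 1)).eval (a - x)) := by
  induction N with
  | zero => simp [wilsonPartialSum, wilsonCoeff_zero]; ring
  | succ N ih =>
    have h := wilsonCoeff_recurrence hab hac had h₀ h₁ h₂ N
    simp only [wilsonPartialSum] at ih ⊢
    rw [sum_range_succ _ (N + 1), sum_range_succ _ (N + 1), sum_range_succ _ (N + 1),
      ascPochhammer_succ_eval (N + 1), ascPochhammer_succ_eval (N + 1)]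
    push_cast
    linear_combination ih + (ascPochhammer K (N + 1)).eval (a + x)
      * (ascPochhammer K (N + 1)).eval (a - x) * h

theorem wilsonCoeff_natCast_eq_zero (a b c d : K) {n k : ℕ} (h : n < k) :
    wilsonCoeff a b c d (n : K) k = 0 := by
  rw [wilsonCoeff, ascPochhammer_eval_neg_coe_nat_of_lt h]
  simp

theorem wilsonPartialSum_natCast_of_lt (a b c d x : K) {n N : ℕ} (h : n < N) :
    wilsonPartialSum a b c d x (n : K) N = wilsonPartialSum a b c d x (n : K) (n + 1) := by
  refine (sum_subset (range_subset_range.2 h) fun k _ hk => ?_).symm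
  rw [wilsonCoeff_natCast_eq_zero _ _ _ _ (by simpa using hk), zero_mul]

end Wilson

theorem Complex.Gamma_eq_mul_Gamma_sub_two {s : ℂ} (h₁ : s ≠ 1) (h₂ : s ≠ 2) :
    Complex.Gamma s = (s - 1) * (s - 2) * Complex.Gamma (s - 2) := by
  have e₁ := Complex.Gamma_add_one (s - 1) (sub_ne_zero.2 h₁)
  have e₂ := Complex.Gamma_add_one (s - 2) (sub_ne_zero.2 h₂)
  rw [sub_add_cancel] at e₁
  rw [show s - 2 + 1 = s - 1 by ring] at e₂
  rw [e₁, e₂, mul_assoc]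

/-- The normalising factor of the `j`-th expansion coefficient, where `u = -c`. -/
noncomputable def cauchyPrefactor (p u : ℂ) (j : ℕ) : ℂ :=
  (-1) ^ j * (2 : ℂ) ^ (-(2 * (j : ℤ)))
    * (Complex.Gamma (u - 2 * (j : ℂ)) * Complex.Gamma (2 * p - 1))
    / (Complex.Gamma (2 * (j : ℂ) + 1) * Complex.Gamma (2 * p - 4 * (j : ℂ) - 1)
      * Complex.Gamma u)

theorem cauchyPrefactor_zero {p u : ℂ} (hp : ∀ n : ℤ, 2 * p ≠ n) (hu : ∀ n : ℤ, u ≠ n) :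
    cauchyPrefactor p u 0 = 1 := by
  have h₁ : Complex.Gamma u ≠ 0 :=
    Complex.Gamma_ne_zero fun m h => hu (-m) (by rw [h]; push_cast; ring)
  have h₂ : Complex.Gamma (2 * p - 1) ≠ 0 :=
    Complex.Gamma_ne_zero fun m h => hp (1 - m) (by push_cast; linear_combination h)
  simp [cauchyPrefactor]
  field_simp

theorem cauchyPrefactor_succ {p u : ℂ} (hp : ∀ n : ℤ, 2 * p ≠ n) (hu : ∀ n : ℤ, u ≠ n)
    (j : ℕ) :
    4 * ((u - 2 * j - 1) * (u - 2 * j - 2)) * ((2 * j + 1) * (2 * j + 2))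
        * cauchyPrefactor p u (j + 1)
      = -((2 * p - 4 * j - 2) * (2 * p - 4 * j - 3) * (2 * p - 4 * j - 4) * (2 * p - 4 * j - 5))
        * cauchyPrefactor p u j := by
  have hpn (n : ℤ) : 2 * p - 4 * j - 1 ≠ n := fun h =>
    hp (n + 4 * j + 1) (by push_cast; linear_combination h)
  have g₁ := Complex.Gamma_eq_mul_Gamma_sub_two (s := u - 2 * j)
    (fun h => hu (2 * j + 1) (by push_cast; linear_combination h))
    (fun h => hu (2 * j + 2) (by push_cast; linear_combination h))
  have g₂ := Complex.Gamma_eq_mul_Gamma_sub_two (s := 2 * p - 4 * j - 1)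
    (by exact_mod_cast hpn 1) (by exact_mod_cast hpn 2)
  have g₃ := Complex.Gamma_eq_mul_Gamma_sub_two (s := 2 * p - 4 * j - 1 - 2)
    (fun h => hpn 3 (by push_cast; linear_combination h))
    (fun h => hpn 4 (by push_cast; linear_combination h))
  have g₄ := Complex.Gamma_eq_mul_Gamma_sub_two (s := 2 * (j : ℂ) + 3)
    (by norm_cast; lia) (by norm_cast; lia)
  have n₀ : Complex.Gamma u ≠ 0 :=
    Complex.Gamma_ne_zero fun m h => hu (-m) (by rw [h]; push_cast; ring)
  have n₁ : Complex.Gamma (2 * p - 4 * j - 5) ≠ 0 :=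
    Complex.Gamma_ne_zero fun m h => hpn (4 - m) (by push_cast; linear_combination h)
  have n₂ : Complex.Gamma (2 * (j : ℂ) + 1) ≠ 0 := by
    rw [show 2 * (j : ℂ) + 1 = ((2 * j : ℕ) : ℂ) + 1 by push_cast; ring,
      Complex.Gamma_nat_eq_factorial]
    exact_mod_cast Nat.factorial_ne_zero _
  have j₁ : 2 * (j : ℂ) + 1 ≠ 0 := by norm_cast
  have j₂ : (j : ℂ) + 1 ≠ 0 := by norm_cast
  have p₁ : 2 * p - 4 * j - 2 ≠ 0 := fun h => hpn 1 (by push_cast; linear_combination h)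
  have p₂ : 2 * p - 4 * j - 3 ≠ 0 := fun h => hpn 2 (by push_cast; linear_combination h)
  have p₃ : 2 * p - 4 * j - 4 ≠ 0 := fun h => hpn 3 (by push_cast; linear_combination h)
  have p₄ : 2 * p - 4 * j - 5 ≠ 0 := fun h => hpn 4 (by push_cast; linear_combination h)
  have z : (2 : ℂ) ^ (-(2 * ((j + 1 : ℕ) : ℤ))) = 2 ^ (-(2 * (j : ℤ))) / 4 := by
    rw [show -(2 * ((j + 1 : ℕ) : ℤ)) = -(2 * (j : ℤ)) - 2 by push_cast; ring,
      zpow_sub₀ two_ne_zero]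
    norm_num
  rw [g₃, show 2 * p - 4 * (j : ℂ) - 1 - 2 - 2 = 2 * p - 4 * j - 5 by ring] at g₂
  rw [show 2 * (j : ℂ) + 3 - 2 = 2 * j + 1 by ring] at g₄
  rw [cauchyPrefactor, cauchyPrefactor, z, g₁, g₂]
  push_cast
  rw [show u - 2 * ((j : ℂ) + 1) = u - 2 * j - 2 by ring,
    show 2 * ((j : ℂ) + 1) + 1 = 2 * j + 3 by ring,
    show 2 * p - 4 * ((j : ℂ) + 1) - 1 = 2 * p - 4 * j - 5 by ring, g₄, pow_succ,
    show 2 * (j : ℂ) + 3 - 1 = 2 * j + 2 by ring,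
    show 2 * p - 4 * (j : ℂ) - 1 - 1 = 2 * p - 4 * j - 2 by ring,
    show 2 * p - 4 * (j : ℂ) - 1 - 2 = 2 * p - 4 * j - 3 by ring,
    show 2 * p - 4 * (j : ℂ) - 3 - 1 = 2 * p - 4 * j - 4 by ring]
  generalize Complex.Gamma (2 * p - 4 * j - 5) = G₁ at *
  generalize Complex.Gamma (2 * (j : ℂ) + 1) = G₂ at *
  generalize Complex.Gamma u = G₃ at *
  generalize Complex.Gamma (u - 2 * j - 2) = G₄ at *
  generalize (j : ℂ) = J at *
  field_simp

/-- **Generalised Cauchy case, expansion coefficients**: with `c = -p + iq`, the real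
solution of the stated three-term recurrence with `α_{-1} = 0`, `α_0 = 1` is given by the
Wilson polynomial value
`α_j = (-1)^j 2^{-2j} Γ(-c-2j)/(Γ(2j+1)Γ(2p-4j-1)) W̃_j(X²/4; (c̄+1)/2, (c+1)/2, 1/2, 0)`,
written out via complex Gamma functions and Pochhammer symbols; in particular the
right-hand side is real. -/
theorem statement18 (X p q : ℝ) (h2p : ∀ n : ℤ, 2 * p ≠ (n : ℝ))
    (α : ℤ → ℝ) (hneg : α (-1) = 0) (h0 : α 0 = 1)
    (hrec : ∀ j : ℕ,
      (X ^ 2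
        + (2 * (j : ℝ) + 1) * (2 * p - 2 * (j : ℝ) - 1) * ((p - 2 * (j : ℝ) - 1) ^ 2 + q ^ 2)
          / ((2 * p - 4 * (j : ℝ) - 1) * (2 * p - 4 * (j : ℝ) - 3))
        + 2 * (j : ℝ) * (2 * p - 2 * (j : ℝ)) * ((p - 2 * (j : ℝ)) ^ 2 + q ^ 2)
          / ((2 * p - 4 * (j : ℝ) - 1) * (2 * p - 4 * (j : ℝ) + 1))) * α j
      = 4 * (2 * (j : ℝ) + 1) * (2 * (j : ℝ) + 2) * (2 * p - 2 * (j : ℝ) - 2)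
          * (2 * p - 2 * (j : ℝ) - 1) * ((p - 2 * (j : ℝ) - 2) ^ 2 + q ^ 2)
          * ((p - 2 * (j : ℝ) - 1) ^ 2 + q ^ 2)
          / ((2 * p - 4 * (j : ℝ) - 5) * (2 * p - 4 * (j : ℝ) - 4)
            * (2 * p - 4 * (j : ℝ) - 3) ^ 2 * (2 * p - 4 * (j : ℝ) - 2)
            * (2 * p - 4 * (j : ℝ) - 1))
          * α (j + 1)
        + (1 / 4 : ℝ) * (2 * p - 4 * (j : ℝ)) * (2 * p - 4 * (j : ℝ) + 2)
          * α ((j : ℤ) - 1)) :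
    ∀ j : ℕ,
      (α j : ℂ) = (-1) ^ j * (2 : ℂ) ^ (-(2 * (j : ℤ)))
        * (Complex.Gamma ((p : ℂ) - (q : ℂ) * Complex.I - 2 * (j : ℂ))
          * Complex.Gamma (2 * (p : ℂ) - 1))
        / (Complex.Gamma (2 * (j : ℂ) + 1) * Complex.Gamma (2 * (p : ℂ) - 4 * (j : ℂ) - 1)
          * Complex.Gamma ((p : ℂ) - (q : ℂ) * Complex.I))
        * ∑ k ∈ Finset.range (j + 1),
            ((ascPochhammer ℂ k).eval (-(j : ℂ))
              * (ascPochhammer ℂ k).eval ((j : ℂ) - (p : ℂ) + 1 / 2)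
              * (ascPochhammer ℂ k).eval
                  ((1 - (p : ℂ) - (q : ℂ) * Complex.I + (X : ℂ) * Complex.I) / 2)
              * (ascPochhammer ℂ k).eval
                  ((1 - (p : ℂ) - (q : ℂ) * Complex.I - (X : ℂ) * Complex.I) / 2))
            / ((ascPochhammer ℂ k).eval (1 - (p : ℂ))
              * (ascPochhammer ℂ k).eval ((2 - (p : ℂ) - (q : ℂ) * Complex.I) / 2)
              * (ascPochhammer ℂ k).eval ((1 - (p : ℂ) - (q : ℂ) * Complex.I) / 2)
              * (Nat.factorial k : ℂ)) := by
  have hP (n : ℤ) : 2 * (p : ℂ) ≠ n := by exact_mod_cast h2p n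
  have hpq (n : ℤ) (ε : ℝ) : (p : ℂ) + ε * (q * Complex.I) ≠ n := fun h =>
    h2p (2 * n) (by
      have := congrArg Complex.re h
      simp at this
      rw [this]; push_cast; ring)
  have hu (n : ℤ) : (p : ℂ) - q * Complex.I ≠ n := fun h =>
    hpq n (-1) (by rw [← h]; push_cast; ring)
  have hw (n : ℤ) : (p : ℂ) + q * Complex.I ≠ n := fun h =>
    hpq n 1 (by rw [← h]; push_cast; ring)
  have hsq (n : ℤ) : (p - n) ^ 2 + q ^ 2 ≠ 0 := fun h => h2p (2 * n) (by
    have : p - n = 0 := by nlinarith [sq_nonneg (p - n), sq_nonneg q]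
    push_cast; linear_combination 2 * this)
  set v : ℂ := q * Complex.I with hv
  have hv2 : (q : ℂ) ^ 2 = -v ^ 2 := by rw [hv, mul_pow, Complex.I_sq]; ring
  set a : ℂ := (1 - p - v) / 2 with ha
  set b : ℂ := (1 - p + v) / 2 with hb
  set x : ℂ := X * Complex.I / 2 with hx
  have hx2 : (X : ℂ) ^ 2 = -4 * x ^ 2 := by rw [hx, div_pow, mul_pow, Complex.I_sq]; ring
  set W : ℂ → ℕ → ℂ := wilsonPartialSum a b (1 / 2) 0 x with hW
  suffices H : ∀ j : ℕ, (α j : ℂ) = cauchyPrefactor p (p - v) j * W j (j + 1) by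
    intro j
    rw [H j, cauchyPrefactor, hW, wilsonPartialSum]
    refine congrArg _ (sum_congr rfl fun k _ => ?_)
    rw [wilsonCoeff, show (j : ℂ) + (a + b + 1 / 2 + 0 - 1) = j - p + 1 / 2 by ring,
      show a + b = 1 - p by ring, show a + 1 / 2 = (2 - p - v) / 2 by ring,
      show a + 0 = (1 - p - v) / 2 by ring,
      show a + x = (1 - p - v + X * Complex.I) / 2 by ring,
      show a - x = (1 - p - v - X * Complex.I) / 2 by ring]
    ring
  have step (j : ℕ) (hj : (α j : ℂ) = cauchyPrefactor p (p - v) j * W j (j + 1))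
      (hprev : (1 / 4 : ℂ) * (2 * p - 4 * j) * (2 * p - 4 * j + 2) * α ((j : ℤ) - 1)
        = -4 * wilsonDown a b (1 / 2) 0 j * cauchyPrefactor p (p - v) j * W (j - 1) (j + 2)) :
      (α (j + 1 : ℕ) : ℂ)
        = cauchyPrefactor p (p - v) (j + 1) * W (j + 1 : ℕ) (j + 1 + 1) := by
    have hPj (n : ℤ) : 2 * (p : ℂ) - 4 * j + n ≠ 0 := fun h =>
      hP (4 * j - n) (by push_cast; linear_combination h)
    have hPj' (n : ℤ) : 2 * (p : ℂ) - 2 * j + n ≠ 0 := fun h =>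
      hP (2 * j - n) (by push_cast; linear_combination h)
    have d₁ : 2 * (p : ℂ) - 4 * j - 1 ≠ 0 := by simpa [← sub_eq_add_neg] using hPj (-1)
    have d₂ : 2 * (p : ℂ) - 4 * j - 2 ≠ 0 := by simpa [← sub_eq_add_neg] using hPj (-2)
    have d₃ : 2 * (p : ℂ) - 4 * j - 3 ≠ 0 := by simpa [← sub_eq_add_neg] using hPj (-3)
    have d₄ : 2 * (p : ℂ) - 4 * j - 4 ≠ 0 := by simpa [← sub_eq_add_neg] using hPj (-4)
    have d₅ : 2 * (p : ℂ) - 4 * j - 5 ≠ 0 := by simpa [← sub_eq_add_neg] using hPj (-5)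
    have d₀ : 2 * (p : ℂ) - 4 * j + 1 ≠ 0 := by simpa using hPj 1
    have c₁ : 2 * (p : ℂ) - 2 * j - 1 ≠ 0 := by simpa [← sub_eq_add_neg] using hPj' (-1)
    have c₂ : 2 * (p : ℂ) - 2 * j - 2 ≠ 0 := by simpa [← sub_eq_add_neg] using hPj' (-2)
    have j₁ : 2 * (j : ℂ) + 1 ≠ 0 := by norm_cast
    have j₂ : 2 * (j : ℂ) + 2 ≠ 0 := by norm_cast
    have s₁ : ((p : ℂ) - 2 * j - 1) ^ 2 + q ^ 2 ≠ 0 := by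
      have := hsq (2 * j + 1)
      push_cast at this
      rw [← sub_sub] at this
      exact_mod_cast this
    have s₂ : ((p : ℂ) - 2 * j - 2) ^ 2 + q ^ 2 ≠ 0 := by
      have := hsq (2 * j + 2)
      push_cast at this
      rw [← sub_sub] at this
      exact_mod_cast this
    have up : 4 * (2 * (j : ℂ) + 1) * (2 * j + 2) * (2 * p - 2 * j - 2) * (2 * p - 2 * j - 1)
          * (((p : ℂ) - 2 * j - 2) ^ 2 + q ^ 2) * (((p : ℂ) - 2 * j - 1) ^ 2 + q ^ 2)
          / ((2 * p - 4 * j - 5) * (2 * p - 4 * j - 4) * (2 * p - 4 * j - 3) ^ 2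
            * (2 * p - 4 * j - 2) * (2 * p - 4 * j - 1)) * cauchyPrefactor p (p - v) (j + 1)
        = -4 * wilsonUp a b (1 / 2) 0 j * cauchyPrefactor p (p - v) j := by
      have h := cauchyPrefactor_succ hP hu j
      have hA : wilsonUp a b (1 / 2) 0 (j : ℂ)
          = (2 * p - 2 * j - 1) * (2 * p - 2 * j - 2) * (p + v - 2 * j - 2) * (p + v - 2 * j - 1)
            / (4 * ((2 * p - 4 * j - 1) * (2 * p - 4 * j - 3))) := by
        rw [wilsonUp, show 2 * (j : ℂ) + (a + b + 1 / 2 + 0 - 1) = -(2 * p - 4 * j - 1) / 2 by ring,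
          show 2 * (j : ℂ) + (a + b + 1 / 2 + 0) = -(2 * p - 4 * j - 3) / 2 by ring]
        field_simp
        ring
      have cancel {e₁ e₂ e₃ e₄ e₅ : ℂ} (L M π π' : ℂ) (h₁ : e₁ ≠ 0) (h₂ : e₂ ≠ 0) (h₃ : e₃ ≠ 0)
          (h₄ : e₄ ≠ 0) (h₅ : e₅ ≠ 0) (h : L * π' = -(e₂ * e₃ * e₄ * e₅) * π) :
          L * M / (e₅ * e₄ * e₃ ^ 2 * e₂ * e₁) * π' = -4 * (M / (4 * (e₁ * e₃))) * π := by
        field_simp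
        linear_combination M * h
      rw [hA, ← cancel _ _ _ _ d₁ d₂ d₃ d₄ d₅ h, hv2]
      ring
    have hB : 4 * (2 * (j : ℂ) + 1) * (2 * j + 2) * (2 * p - 2 * j - 2) * (2 * p - 2 * j - 1)
          * (((p : ℂ) - 2 * j - 2) ^ 2 + q ^ 2) * (((p : ℂ) - 2 * j - 1) ^ 2 + q ^ 2)
          / ((2 * p - 4 * j - 5) * (2 * p - 4 * j - 4) * (2 * p - 4 * j - 3) ^ 2
            * (2 * p - 4 * j - 2) * (2 * p - 4 * j - 1)) ≠ 0 := by
      simp [d₁, d₂, d₃, d₄, d₅, c₁, c₂, j₁, j₂, s₁, s₂]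
    have mid : (X : ℂ) ^ 2
          + (2 * j + 1) * (2 * p - 2 * j - 1) * (((p : ℂ) - 2 * j - 1) ^ 2 + q ^ 2)
            / ((2 * p - 4 * j - 1) * (2 * p - 4 * j - 3))
          + 2 * j * (2 * p - 2 * j) * (((p : ℂ) - 2 * j) ^ 2 + q ^ 2)
            / ((2 * p - 4 * j - 1) * (2 * p - 4 * j + 1))
        = -4 * (wilsonUp a b (1 / 2) 0 (j : ℂ) + wilsonDown a b (1 / 2) 0 (j : ℂ)
          - (a ^ 2 - x ^ 2)) := by
      rw [wilsonUp, wilsonDown,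
        show 2 * (j : ℂ) + (a + b + 1 / 2 + 0 - 1) = -(2 * p - 4 * j - 1) / 2 by ring,
        show 2 * (j : ℂ) + (a + b + 1 / 2 + 0) = -(2 * p - 4 * j - 3) / 2 by ring,
        show 2 * (j : ℂ) + (a + b + 1 / 2 + 0 - 2) = -(2 * p - 4 * j + 1) / 2 by ring,
        hx2, hv2, ha, hb]
      field_simp
      ring
    have hrecW := wilsonPartialSum_recurrence (a := a) (b := b) (c := 1 / 2) (d := 0)
      (ν := (j : ℂ)) x
      (fun m h => hP (2 * (m + 1)) (by push_cast; linear_combination -2 * h))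
      (fun m h => hw (2 * m + 2) (by push_cast; linear_combination -2 * h))
      (fun m h => hw (2 * m + 1) (by push_cast; linear_combination -2 * h))
      (fun h => d₀ (by linear_combination -2 * h))
      (fun h => d₁ (by linear_combination -2 * h))
      (fun h => d₃ (by linear_combination -2 * h)) (j + 1)
    rw [wilsonCoeff_natCast_eq_zero _ _ _ _ j.lt_succ_self, zero_mul,
      wilsonPartialSum_natCast_of_lt _ _ _ _ _ (show j < j + 1 + 1 by lia)] at hrecW
    have hR := congrArg (fun r : ℝ => (r : ℂ)) (hrec j)
    push_cast at hR
    rw [hj, hprev, mid] at hR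
    push_cast
    refine mul_left_cancel₀ hB ?_
    linear_combination -hR - W (j + 1) (j + 1 + 1) * up
      + 4 * cauchyPrefactor p (p - v) j * hrecW
  have base : (α (0 : ℕ) : ℂ) = cauchyPrefactor p (p - v) 0 * W (0 : ℕ) (0 + 1) := by
    simp [cauchyPrefactor_zero hP hu, h0, hW, wilsonPartialSum, wilsonCoeff_zero]
  have succ (m : ℕ) (hm : (α m : ℂ) = cauchyPrefactor p (p - v) m * W m (m + 1)) :
      (1 / 4 : ℂ) * (2 * p - 4 * (m + 1 : ℕ)) * (2 * p - 4 * (m + 1 : ℕ) + 2)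
          * α (((m + 1 : ℕ) : ℤ) - 1)
        = -4 * wilsonDown a b (1 / 2) 0 (m + 1 : ℕ) * cauchyPrefactor p (p - v) (m + 1)
          * W ((m + 1 : ℕ) - 1) (m + 1 + 2) := by
    have h := cauchyPrefactor_succ hP hu m
    have d₃ : 2 * (p : ℂ) - 4 * m - 3 ≠ 0 := fun h =>
      hP (4 * m + 3) (by push_cast; linear_combination h)
    have d₅ : 2 * (p : ℂ) - 4 * m - 5 ≠ 0 := fun h =>
      hP (4 * m + 5) (by push_cast; linear_combination h)
    have hC : wilsonDown a b (1 / 2) 0 ((m + 1 : ℕ) : ℂ)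
        = (2 * m + 2) * (2 * m + 1) * (p - v - 2 * m - 1) * (p - v - 2 * m - 2)
          / (4 * ((2 * p - 4 * m - 3) * (2 * p - 4 * m - 5))) := by
      push_cast
      rw [wilsonDown,
        show 2 * ((m : ℂ) + 1) + (a + b + 1 / 2 + 0 - 1) = -(2 * p - 4 * m - 5) / 2 by ring,
        show 2 * ((m : ℂ) + 1) + (a + b + 1 / 2 + 0 - 2) = -(2 * p - 4 * m - 3) / 2 by ring, hb]
      field_simp
      ring
    rw [hC]
    push_cast
    rw [add_sub_cancel_right, add_sub_cancel_right, hm, hW,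
      wilsonPartialSum_natCast_of_lt _ _ _ _ _ (show m < m + 1 + 2 by lia)]
    field_simp
    linear_combination wilsonPartialSum a b (1 / 2) 0 x m (m + 1) * h
  suffices H : ∀ j : ℕ, (α j : ℂ) = cauchyPrefactor p (p - v) j * W j (j + 1)
      ∧ (1 / 4 : ℂ) * (2 * p - 4 * j) * (2 * p - 4 * j + 2) * α ((j : ℤ) - 1)
        = -4 * wilsonDown a b (1 / 2) 0 j * cauchyPrefactor p (p - v) j * W (j - 1) (j + 2) from
    fun j => (H j).1
  intro j
  induction j with
  | zero => exact ⟨base, by simp [hneg, wilsonDown]⟩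
  | succ j ih => exact ⟨step j ih.1 ih.2, succ j ih.1⟩
end
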